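/- Let Q be an inverse semigroup and let b, c, u, v ∈ Q with u 𝓡 v. Then b·c⁻¹ = u⁻¹·v if and only if u·b = v·c, v 𝓡 v·c, and (u·b)⁻¹·(u·b) = b⁻¹·b·c⁻¹·c (the last condition saying that the 𝓛-class of u·b is the meet of the 𝓛-classes of b and c). -/

import Mathlib

section InverseSemigroup

variable {Q : Type*} [Semigroup Q]

theorem eq_of_mutual_inverses
    (hcomm : ∀ e f : Q, e * e = e → f * f = f → e * f = f * e) {a x y : Q}
    (hx : a * x * a = a) (hx' : x * a * x = x) (hy : a * y * a = a) (hy' : y * a * y = y) :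
    x = y := by
  have hl : (x * a) * (y * a) = (y * a) * (x * a) :=
    hcomm _ _ (by rw [← mul_assoc, hx']) (by rw [← mul_assoc, hy'])
  have hr : (a * x) * (a * y) = (a * y) * (a * x) :=
    hcomm _ _ (by rw [← mul_assoc, hx]) (by rw [← mul_assoc, hy])
  calc x = x * (a * y * a) * x := by rw [hy, hx']
    _ = (x * a) * (y * a) * x := by simp only [mul_assoc]
    _ = y * (a * x * a) * x := by rw [hl]; simp only [mul_assoc]
    _ = y * (a * y * a) * x := by rw [hx, hy]
    _ = y * ((a * y) * (a * x)) := by simp only [mul_assoc]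
    _ = y * (a * x * a) * y := by rw [← hr]; simp only [mul_assoc]
    _ = y := by rw [hx, hy']

theorem inverse_inverse {inv : Q → Q} (hinv1 : ∀ a : Q, a * inv a * a = a)
    (hinv2 : ∀ a : Q, inv a * a * inv a = inv a)
    (hcomm : ∀ e f : Q, e * e = e → f * f = f → e * f = f * e)
    (a : Q) : inv (inv a) = a :=
  eq_of_mutual_inverses hcomm (hinv1 _) (hinv2 _) (hinv2 a) (hinv1 a)

theorem range_mul_domain_comm {inv : Q → Q} (hinv1 : ∀ a : Q, a * inv a * a = a)
    (hinv2 : ∀ a : Q, inv a * a * inv a = inv a)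
    (hcomm : ∀ e f : Q, e * e = e → f * f = f → e * f = f * e)
    (a b : Q) :
    (inv a * a) * (b * inv b) = (b * inv b) * (inv a * a) :=
  hcomm _ _ (by rw [← mul_assoc, hinv2]) (by rw [← mul_assoc, hinv1])

theorem range_mul_range_comm {inv : Q → Q}
    (hinv2 : ∀ a : Q, inv a * a * inv a = inv a)
    (hcomm : ∀ e f : Q, e * e = e → f * f = f → e * f = f * e)
    (a b : Q) :
    (inv a * a) * (inv b * b) = (inv b * b) * (inv a * a) :=
  hcomm _ _ (by rw [← mul_assoc, hinv2]) (by rw [← mul_assoc, hinv2])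

theorem inverse_mul {inv : Q → Q} (hinv1 : ∀ a : Q, a * inv a * a = a)
    (hinv2 : ∀ a : Q, inv a * a * inv a = inv a)
    (hcomm : ∀ e f : Q, e * e = e → f * f = f → e * f = f * e)
    (a b : Q) : inv (a * b) = inv b * inv a := by
  have h := range_mul_domain_comm hinv1 hinv2 hcomm a b
  refine eq_of_mutual_inverses hcomm (hinv1 _) (hinv2 _) ?_ ?_
  · calc a * b * (inv b * inv a) * (a * b)
        = a * ((b * inv b) * (inv a * a)) * b := by simp only [mul_assoc]
      _ = (a * inv a * a) * (b * inv b * b) := by rw [← h]; simp only [mul_assoc]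
      _ = a * b := by rw [hinv1, hinv1]
  · calc inv b * inv a * (a * b) * (inv b * inv a)
        = inv b * ((inv a * a) * (b * inv b)) * inv a := by simp only [mul_assoc]
      _ = (inv b * b * inv b) * (inv a * a * inv a) := by rw [h]; simp only [mul_assoc]
      _ = inv b * inv a := by rw [hinv2, hinv2]

end InverseSemigroup


/-- In an inverse semigroup, for `u 𝓡 v`, `b·c⁻¹ = u⁻¹·v` iff
`u·b = v·c`, `v 𝓡 v·c` and the 𝓛-class of `u·b` is the meet of those of `b` and `c`. -/
theorem quotient_product_switch
    {Q : Type*} [Semigroup Q] (inv : Q → Q)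
    (hinv1 : ∀ a : Q, a * inv a * a = a)
    (hinv2 : ∀ a : Q, inv a * a * inv a = inv a)
    (hcomm : ∀ e f : Q, e * e = e → f * f = f → e * f = f * e)
    (b c u v : Q) (huv : u * inv u = v * inv v) :
    b * inv c = inv u * v ↔
      (u * b = v * c ∧ v * inv v = (v * c) * inv (v * c) ∧
        inv (u * b) * (u * b) = inv b * b * (inv c * c)) := by
  have hmul := inverse_mul hinv1 hinv2 hcomm
  have hii := inverse_inverse hinv1 hinv2 hcomm
  have hbc := range_mul_range_comm hinv2 hcomm b c
  constructor
  · intro h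
    have hu : inv u * u = b * inv c * c * inv b := by
      calc inv u * u = inv u * (u * inv u) * u := by rw [← mul_assoc, hinv2]
        _ = (inv u * v) * inv (inv u * v) := by rw [huv, hmul, hii]; simp only [mul_assoc]
        _ = b * inv c * c * inv b := by rw [← h, hmul, hii]; simp only [mul_assoc]
    have hv : inv v * v = c * inv b * b * inv c := by
      calc inv v * v = inv v * (v * inv v) * v := by rw [← mul_assoc, hinv2]
        _ = inv (inv u * v) * (inv u * v) := by rw [← huv, hmul, hii]; simp only [mul_assoc]
        _ = c * inv b * b * inv c := by rw [← h, hmul, hii]; simp only [mul_assoc]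
    have hvc : v * c * inv c = v := by
      calc v * c * inv c = v * (inv v * v) * c * inv c := by rw [← mul_assoc v, hinv1]
        _ = v * (c * inv b * b * (inv c * c * inv c)) := by rw [hv]; simp only [mul_assoc]
        _ = v := by rw [hinv2, ← hv, ← mul_assoc, hinv1]
    refine ⟨?_, ?_, ?_⟩
    · calc u * b = u * (inv u * u) * b := by rw [← mul_assoc, hinv1]
        _ = u * b * ((inv c * c) * (inv b * b)) := by rw [hu]; simp only [mul_assoc]
        _ = u * (b * inv b * b) * inv c * c := by rw [← hbc]; simp only [mul_assoc]
        _ = u * (b * inv c) * c := by rw [hinv1]; simp only [mul_assoc]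
        _ = (u * inv u) * v * c := by rw [h]; simp only [mul_assoc]
        _ = v * c := by rw [huv, hinv1]
    · rw [hmul, ← mul_assoc, hvc]
    · calc inv (u * b) * (u * b) = inv b * (inv u * u) * b := by
            rw [hmul]; simp only [mul_assoc]
        _ = inv b * b * ((inv c * c) * (inv b * b)) := by rw [hu]; simp only [mul_assoc]
        _ = (inv b * b * inv b) * b * (inv c * c) := by rw [← hbc]; simp only [mul_assoc]
        _ = inv b * b * (inv c * c) := by rw [hinv2]
  · rintro ⟨h, hR, hL⟩
    have absorb (x y : Q) (hxy : x * inv x = (x * y) * inv (x * y)) :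
        x * y * inv y = x := by
      have hd := range_mul_domain_comm hinv1 hinv2 hcomm x y
      calc x * y * inv y = (x * inv x * x) * (y * inv y) := by rw [hinv1, mul_assoc]
        _ = x * ((inv x * x) * (y * inv y)) := by simp only [mul_assoc]
        _ = x * y * (inv y * inv x) * x := by rw [hd]; simp only [mul_assoc]
        _ = x := by rw [← hmul, ← hxy, hinv1]
    have hvc := absorb v c hR
    have hub := absorb u b (by rw [huv, hR, h])
    have hub' : b * inv b * inv u = inv u := by
      have := congrArg inv hub
      rwa [hmul, hmul, hii, ← mul_assoc] at this
    calc b * inv c = (b * inv b * b) * (inv c * c * inv c) := by rw [hinv1, hinv2]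
      _ = b * (inv b * b * (inv c * c)) * inv c := by simp only [mul_assoc]
      _ = b * (inv (u * b) * (v * c)) * inv c := by rw [← hL, ← h]
      _ = (b * inv b * inv u) * (v * c * inv c) := by rw [hmul]; simp only [mul_assoc]
      _ = inv u * v := by rw [hub', hvc]
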